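/- arXiv:math/0410454 — 2 statements merged into one kernel-verified Lean document; each statement's English description precedes it below -/
import Mathlib

section
/- Let I ⊆ S. Every element b of B⁺ admits a unique maximal left divisor lying in B⁺_I: there exists a unique α_I(b) ∈ B⁺_I such that α_I(b) ≼ b and every c ∈ B⁺_I with c ≼ b satisfies c ≼ α_I(b). -/
/-!
Artin–Tits braid monoid of a finite Coxeter system `(W,S)`, presented with one
generator `𝐰` for each `w ∈ W` and relations `𝐰₁𝐰₂ = 𝐰` when `w = w₁w₂` with
`l(w₁) + l(w₂) = l(w)`.
-/

variable {B : Type*} {W : Type*} [Group W] {M : CoxeterMatrix B}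

/-- The defining relations of the braid monoid. -/
def braidRel (cs : CoxeterSystem M W) : FreeMonoid W → FreeMonoid W → Prop := fun a b =>
  ∃ w₁ w₂ : W, cs.length (w₁ * w₂) = cs.length w₁ + cs.length w₂ ∧
    a = FreeMonoid.of w₁ * FreeMonoid.of w₂ ∧ b = FreeMonoid.of (w₁ * w₂)

/-- The braid monoid `B⁺` of the Coxeter system `cs`. -/
abbrev BraidMonoid (cs : CoxeterSystem M W) := PresentedMonoid (braidRel cs)

/-- The canonical element `𝐰 ∈ B⁺` attached to `w ∈ W`. -/
def bOf (cs : CoxeterSystem M W) (w : W) : BraidMonoid cs := PresentedMonoid.of (braidRel cs) w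

/-- The canonical morphism `β : B⁺ → W`, `𝐰 ↦ w`. -/
noncomputable def bPi (cs : CoxeterSystem M W) : BraidMonoid cs →* W :=
  PresentedMonoid.lift (fun w : W => w) (by
    rintro a b ⟨w₁, w₂, -, rfl, rfl⟩
    simp)

/-- The additive length morphism `l : B⁺ → ℕ` with `l(𝐬) = 1`; recorded as a morphism
to `Multiplicative ℕ`. It sends `𝐰` to `l(w)`. -/
noncomputable def bLen (cs : CoxeterSystem M W) : BraidMonoid cs →* Multiplicative ℕ :=
  PresentedMonoid.lift (fun w : W => Multiplicative.ofAdd (cs.length w)) (by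
    rintro a b ⟨w₁, w₂, h, rfl, rfl⟩
    simp [← ofAdd_add, h])

/-- The set `𝐖 = {b ∈ B⁺ : l(b) = l(β(b))}`, a copy of `W` inside `B⁺`. -/
def bW (cs : CoxeterSystem M W) : Set (BraidMonoid cs) :=
  {b | bLen cs b = Multiplicative.ofAdd (cs.length (bPi cs b))}

/-- For `I ⊆ S` (given as a set of indices of simple reflections), the submonoid
`B⁺_I` of `B⁺` generated by the `𝐬`, `s ∈ I`. -/
def bSub (cs : CoxeterSystem M W) (I : Set B) : Submonoid (BraidMonoid cs) :=
  Submonoid.closure ((fun i => bOf cs (cs.simple i)) '' I)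

open Relation in
/-- Newman's lemma: a terminating, locally confluent relation sends each element to a common
descendant of all its descendants. -/
theorem exists_final_of_locally_confluent {X : Type*} {r : X → X → Prop}
    (wf : WellFounded fun a b => r b a)
    (hr : ∀ x y z, r x y → r x z → ∃ w, ReflTransGen r y w ∧ ReflTransGen r z w) (x : X) :
    ∃ m, ReflTransGen r x m ∧ ∀ y, ReflTransGen r x y → ReflTransGen r y m := by
  induction x using wf.induction with
  | _ x ih =>
    by_cases h : ∃ y, r x y
    · obtain ⟨y, hxy⟩ := h
      obtain ⟨m, hym, hm⟩ := ih y hxy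
      refine ⟨m, .head hxy hym, fun y' hy' => ?_⟩
      rcases ReflTransGen.cases_head hy' with rfl | ⟨z, hxz, hzy'⟩
      · exact .head hxy hym
      · obtain ⟨m', -, hm'⟩ := ih z hxz
        obtain ⟨w, hyw, hzw⟩ := hr x y z hxy hxz
        have hmm' := hm' m (hzw.trans (hm w hyw))
        exact (hm' y' hzy').trans (hm m' (hym.trans hmm'))
    · push Not at h
      refine ⟨x, .refl, fun y hy => ?_⟩
      rcases ReflTransGen.cases_head hy with rfl | ⟨z, hxz, -⟩
      · exact .refl
      · exact absurd hxz (h z)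

namespace CoxeterSystem

section Exchange

open Classical in
/-- The action of a simple reflection on `W × ZMod 2` which conjugates the first component and
records in the second one whether the first component is that simple reflection. -/
noncomputable def reflPerm (cs : CoxeterSystem M W) (i : B) : Function.End (W × ZMod 2) := fun p =>
  (cs.simple i * p.1 * cs.simple i, p.2 + if p.1 = cs.simple i then 1 else 0)

theorem simple_mul_pow (cs : CoxeterSystem M W) (i j : B) (n : ℕ) :
    cs.simple j * (cs.simple i * cs.simple j) ^ n =
      ((cs.simple i * cs.simple j) ^ n)⁻¹ * cs.simple j := by
  induction n with
  | zero => simp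
  | succ n ih =>
    rw [pow_succ, ← mul_assoc, ih, ← pow_succ, pow_succ' _ n]
    simp [mul_assoc]

open Classical in
theorem reflPerm_mul_pow_apply (cs : CoxeterSystem M W) (i j : B) (n : ℕ) (t : W) (ε : ZMod 2) :
    ((cs.reflPerm i * cs.reflPerm j) ^ n : Function.End (W × ZMod 2)) (t, ε) =
      ((cs.simple i * cs.simple j) ^ n * t * ((cs.simple i * cs.simple j) ^ n)⁻¹,
        ε + ∑ k ∈ Finset.range (2 * n),
          if t = ((cs.simple i * cs.simple j) ^ k)⁻¹ * cs.simple j then 1 else 0) := by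
  induction n with
  | zero =>
    change (t, ε) = _
    simp
  | succ n ih =>
    rw [pow_succ']
    change cs.reflPerm i (cs.reflPerm j
      (((cs.reflPerm i * cs.reflPerm j) ^ n : Function.End (W × ZMod 2)) (t, ε))) = _
    rw [ih]
    set c := cs.simple i * cs.simple j with hc
    have hconj := cs.simple_mul_pow i j n
    rw [← hc] at hconj
    have hj : ∀ x, cs.simple j * (cs.simple j * x) = x :=
      fun x => cs.simple_mul_simple_cancel_left j
    have h2n : (c ^ (2 * n))⁻¹ = (c ^ n)⁻¹ * (c ^ n)⁻¹ := by rw [two_mul, pow_add, mul_inv_rev]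
    have e1 : c ^ n * t * (c ^ n)⁻¹ = cs.simple j ↔ t = (c ^ (2 * n))⁻¹ * cs.simple j := by
      rw [h2n, mul_assoc _ _ (cs.simple j), ← hconj, mul_inv_eq_iff_eq_mul, eq_inv_mul_iff_mul_eq]
    have e2 : cs.simple j * (c ^ n * t * (c ^ n)⁻¹) * cs.simple j = cs.simple i ↔
        t = (c ^ (2 * n + 1))⁻¹ * cs.simple j := by
      have : (c ^ (2 * n + 1))⁻¹ * cs.simple j =
          (c ^ n)⁻¹ * (cs.simple j * cs.simple i * cs.simple j) * c ^ n := by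
        rw [pow_succ', mul_inv_rev, h2n, hc, mul_inv_rev, inv_simple, inv_simple, ← hc]
        have h' : c ^ n * (cs.simple j * cs.simple i) = (cs.simple j * cs.simple i) * c ^ n := by
          have : cs.simple j * cs.simple i = c⁻¹ := by simp [hc]
          rw [this]; exact ((Commute.refl c).pow_left n).inv_right.eq
        have h'' : (c ^ n)⁻¹ * (cs.simple j * cs.simple i) =
            (cs.simple j * cs.simple i) * (c ^ n)⁻¹ := by
          rw [inv_mul_eq_iff_eq_mul, ← mul_assoc, h', mul_assoc, mul_inv_cancel, mul_one]
        calc _ = (c ^ n)⁻¹ * ((c ^ n)⁻¹ * (cs.simple j * cs.simple i)) * cs.simple j := by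
              simp [mul_assoc]
          _ = (c ^ n)⁻¹ * (cs.simple j * cs.simple i) * ((c ^ n)⁻¹ * cs.simple j) := by
              conv_lhs => rw [h'']
              simp [mul_assoc]
          _ = _ := by rw [← hconj]; simp [mul_assoc]
      rw [this]
      constructor
      · intro h
        have : c ^ n * t * (c ^ n)⁻¹ = cs.simple j * cs.simple i * cs.simple j := by
          rw [← h]; simp [mul_assoc, hj]
        rw [← this]; group
      · rintro rfl
        have : c ^ n * ((c ^ n)⁻¹ * (cs.simple j * cs.simple i * cs.simple j) * c ^ n) * (c ^ n)⁻¹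
          = cs.simple j * cs.simple i * cs.simple j := by group
        rw [this]; simp [mul_assoc, hj]
    simp only [reflPerm, e1, e2]
    rw [show 2 * (n + 1) = 2 * n + 1 + 1 by ring, Finset.sum_range_succ, Finset.sum_range_succ]
    refine Prod.ext ?_ ?_
    · rw [pow_succ' c n, mul_inv_rev, hc]; simp [mul_assoc]
    · simp only [add_assoc]

theorem reflPerm_isLiftable (cs : CoxeterSystem M W) : M.IsLiftable cs.reflPerm := by
  classical
  intro i j
  funext ⟨t, ε⟩
  rw [reflPerm_mul_pow_apply]
  simp only [simple_mul_simple_pow, two_mul, Finset.sum_range_add, pow_add, one_mul]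
  simp only [CharTwo.add_self_eq_zero]
  change _ = (t, ε)
  simp

open Classical in
theorem lift_reflPerm_apply (cs : CoxeterSystem M W) (ω : List B) (t : W) (ε : ZMod 2) :
    cs.lift ⟨cs.reflPerm, cs.reflPerm_isLiftable⟩ (cs.wordProd ω) (t, ε) =
      (cs.wordProd ω * t * (cs.wordProd ω)⁻¹, ε + ((cs.rightInvSeq ω).count t : ℕ)) := by
  induction ω with
  | nil =>
    rw [wordProd_nil, map_one]
    change (t, ε) = _
    simp
  | cons i ω ih =>
    rw [wordProd_cons, map_mul, lift_apply_simple]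
    change cs.reflPerm i
      (cs.lift ⟨cs.reflPerm, cs.reflPerm_isLiftable⟩ (cs.wordProd ω) (t, ε)) = _
    rw [ih, rightInvSeq, List.count_cons, reflPerm]
    refine Prod.ext (by simp [mul_assoc]) ?_
    have : cs.wordProd ω * t * (cs.wordProd ω)⁻¹ = cs.simple i ↔
        (cs.wordProd ω)⁻¹ * cs.simple i * cs.wordProd ω = t := by
      rw [mul_inv_eq_iff_eq_mul, mul_assoc, inv_mul_eq_iff_eq_mul, eq_comm]
    simp [this, add_assoc]

theorem simple_mem_rightInvSeq (cs : CoxeterSystem M W) {ω : List B} {i : B}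
    (h : cs.IsRightDescent (cs.wordProd ω) i) : cs.simple i ∈ cs.rightInvSeq ω := by
  classical
  obtain ⟨ω', hω', hw⟩ := cs.exists_isReduced (cs.wordProd ω * cs.simple i)
  have hprod : cs.wordProd ω = cs.wordProd (ω'.concat i) := by
    rw [wordProd_concat, ← hw]; simp
  have hnot : cs.simple i ∉ cs.rightInvSeq ω' := fun hmem => by
    have := (cs.isRightInversion_of_mem_rightInvSeq hω' hmem).2
    rw [← hw, simple_mul_simple_cancel_right] at this
    exact lt_asymm this h
  have hcount : (cs.rightInvSeq (ω'.concat i)).count (cs.simple i) = 1 := by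
    rw [rightInvSeq_concat, List.concat_eq_append, List.count_append, List.count_singleton_self,
      Nat.add_eq_right, List.count_eq_zero]
    intro hmem
    obtain ⟨t, ht, hti⟩ := List.mem_map.mp hmem
    apply hnot
    have : t = cs.simple i := by
      rw [MulAut.conj_apply, mul_inv_eq_iff_eq_mul] at hti
      exact mul_left_cancel hti
    rwa [← this]
  have h1 := cs.lift_reflPerm_apply ω (cs.simple i) 0
  rw [hprod, lift_reflPerm_apply, hcount] at h1
  have h2 := congrArg Prod.snd h1
  by_contra hmem
  rw [List.count_eq_zero.mpr hmem] at h2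
  simp at h2

/-- The exchange property. -/
theorem exists_simple_mul_wordProd_eq_eraseIdx (cs : CoxeterSystem M W) {ω : List B} {i : B}
    (h : cs.IsLeftDescent (cs.wordProd ω) i) :
    ∃ j < ω.length, cs.simple i * cs.wordProd ω = cs.wordProd (ω.eraseIdx j) := by
  have hmem : cs.simple i ∈ cs.leftInvSeq ω := by
    rw [← List.mem_reverse, ← rightInvSeq_reverse]
    apply simple_mem_rightInvSeq
    rwa [wordProd_reverse, isRightDescent_inv_iff]
  obtain ⟨j, hj, hji⟩ := List.mem_iff_getElem.mp hmem
  refine ⟨j, by simpa using hj, ?_⟩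
  rw [← getD_leftInvSeq_mul_wordProd, List.getD_eq_getElem _ 1 hj, hji]

end Exchange

end CoxeterSystem

namespace CoxeterSystem

section WeakOrder

/-- The right weak order on a Coxeter group: `y` is the product of an initial segment of a reduced
word for `q`. -/
def WeakLE (cs : CoxeterSystem M W) (y q : W) : Prop :=
  cs.length y + cs.length (y⁻¹ * q) = cs.length q

theorem WeakLE.trans {cs : CoxeterSystem M W} {x y z : W} (h : cs.WeakLE x y)
    (h' : cs.WeakLE y z) : cs.WeakLE x z := by
  unfold WeakLE at *
  have h1 := cs.length_mul_le (x⁻¹ * y) (y⁻¹ * z)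
  have h2 := cs.length_mul_le x (x⁻¹ * z)
  simp only [mul_assoc, mul_inv_cancel_left] at h1 h2
  omega

theorem WeakLE.antisymm {cs : CoxeterSystem M W} {x y : W} (h : cs.WeakLE x y)
    (h' : cs.WeakLE y x) : x = y := by
  unfold WeakLE at *
  have h0 : cs.length (x⁻¹ * y) = 0 := by omega
  rwa [length_eq_zero_iff, inv_mul_eq_one] at h0

theorem weakLE_one (cs : CoxeterSystem M W) (q : W) : cs.WeakLE 1 q := by
  simp [WeakLE]

theorem weakLE_simple_iff (cs : CoxeterSystem M W) {q : W} {i : B} :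
    cs.WeakLE (cs.simple i) q ↔ cs.IsLeftDescent q i := by
  rw [isLeftDescent_iff, WeakLE, length_simple, inv_simple, add_comm]

theorem weakLE_mul_iff (cs : CoxeterSystem M W) {x y : W} :
    cs.WeakLE x (x * y) ↔ cs.length (x * y) = cs.length x + cs.length y := by
  rw [WeakLE, inv_mul_cancel_left, eq_comm]

/-- If `x ≤ q`, then `x * y ≤ q` and `x ≤ x * y` hold if and only if `y ≤ x⁻¹ * q`. -/
theorem WeakLE.le_inv_mul_iff {cs : CoxeterSystem M W} {x y q : W} (h : cs.WeakLE x q) :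
    cs.WeakLE y (x⁻¹ * q) ↔ cs.WeakLE x (x * y) ∧ cs.WeakLE (x * y) q := by
  unfold WeakLE at *
  have h1 := cs.length_mul_le x y
  have h2 := cs.length_mul_le y (y⁻¹ * (x⁻¹ * q))
  have h3 := cs.length_mul_le (x * y) (y⁻¹ * (x⁻¹ * q))
  simp only [mul_inv_rev, mul_assoc, mul_inv_cancel_left, inv_mul_cancel_left] at h1 h2 h3 ⊢
  omega

theorem WeakLE.simple_mul {cs : CoxeterSystem M W} {y q : W} {i : B} (h : cs.WeakLE y q)
    (hq : cs.IsLeftDescent q i) (hy : ¬cs.IsLeftDescent y i) :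
    cs.WeakLE (cs.simple i * y) q := by
  rw [not_isLeftDescent_iff] at hy
  obtain ⟨ω, hω, rfl⟩ := cs.exists_isReduced y
  obtain ⟨ω', hω', hr⟩ := cs.exists_isReduced ((cs.wordProd ω)⁻¹ * q)
  have hq' : q = cs.wordProd (ω ++ ω') := by rw [wordProd_append, ← hr, mul_inv_cancel_left]
  subst hq'
  obtain ⟨j, hj, hji⟩ := cs.exists_simple_mul_wordProd_eq_eraseIdx hq
  unfold WeakLE at *
  rw [hr, hω'.eq] at h
  rw [hω.eq] at h hy
  rcases lt_or_ge j ω.length with hlt | hge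
  · rw [List.eraseIdx_append_of_lt_length hlt, wordProd_append, wordProd_append, ← mul_assoc,
      mul_left_inj] at hji
    have h1 := cs.length_wordProd_le (ω.eraseIdx j)
    rw [← hji, hy, List.length_eraseIdx_of_lt hlt] at h1
    omega
  · rw [List.eraseIdx_append_of_length_le hge, wordProd_append, wordProd_append] at hji
    have hj' : j - ω.length < ω'.length := by rw [List.length_append] at hj; omega
    have h1 := cs.length_wordProd_le (ω'.eraseIdx (j - ω.length))
    rw [List.length_eraseIdx_of_lt hj'] at h1
    have h2 : (cs.simple i * cs.wordProd ω)⁻¹ * cs.wordProd (ω ++ ω') =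
        cs.wordProd (ω'.eraseIdx (j - ω.length)) := by
      rw [mul_inv_rev, inv_simple, mul_assoc, wordProd_append, hji, inv_mul_cancel_left]
    have h3 := cs.length_mul_le (cs.simple i * cs.wordProd ω)
      ((cs.simple i * cs.wordProd ω)⁻¹ * cs.wordProd (ω ++ ω'))
    rw [mul_inv_cancel_left] at h3
    rw [h2] at h3 ⊢
    omega

/-- The elements of `W` admitting a reduced expression with letters in `J`. -/
def parabolic (cs : CoxeterSystem M W) (J : Set B) : Set W :=
  {y | ∃ ω : List B, (∀ i ∈ ω, i ∈ J) ∧ cs.IsReduced ω ∧ cs.wordProd ω = y}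

theorem one_mem_parabolic (cs : CoxeterSystem M W) (J : Set B) : 1 ∈ cs.parabolic J :=
  ⟨[], by simp, by simp [IsReduced], by simp⟩

theorem mem_parabolic_univ (cs : CoxeterSystem M W) (y : W) : y ∈ cs.parabolic Set.univ := by
  obtain ⟨ω, hω, rfl⟩ := cs.exists_isReduced y
  exact ⟨ω, by simp, hω, rfl⟩

theorem simple_mul_mem_parabolic (cs : CoxeterSystem M W) {J : Set B} {y : W} {i : B} (hi : i ∈ J)
    (hy : y ∈ cs.parabolic J) : cs.simple i * y ∈ cs.parabolic J := by
  obtain ⟨ω, hωJ, hω, rfl⟩ := hy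
  by_cases hd : cs.IsLeftDescent (cs.wordProd ω) i
  · obtain ⟨j, hj, hji⟩ := cs.exists_simple_mul_wordProd_eq_eraseIdx hd
    refine ⟨ω.eraseIdx j, fun k hk => hωJ k (List.mem_of_mem_eraseIdx hk), ?_, hji.symm⟩
    rw [isLeftDescent_iff, hω.eq, hji] at hd
    rw [IsReduced, List.length_eraseIdx_of_lt hj]
    omega
  · refine ⟨i :: ω, by simpa using ⟨hi, hωJ⟩, ?_, wordProd_cons ..⟩
    rw [not_isLeftDescent_iff, ← wordProd_cons, hω.eq] at hd
    rw [IsReduced, hd, List.length_cons]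

theorem weakLE_of_mem_parabolic (cs : CoxeterSystem M W) {J : Set B} {y q : W}
    (hq : ∀ i ∈ J, cs.IsLeftDescent q i) (hy : y ∈ cs.parabolic J) : cs.WeakLE y q := by
  obtain ⟨ω, hωJ, hω, rfl⟩ := hy
  induction ω with
  | nil => simpa using cs.weakLE_one q
  | cons i ω ih =>
    have hred : cs.IsReduced ω := hω.drop 1
    rw [wordProd_cons]
    refine (ih (fun k hk => hωJ k (List.mem_cons_of_mem _ hk)) hred).simple_mul
      (hq i (hωJ i List.mem_cons_self)) ?_
    rw [not_isLeftDescent_iff, ← wordProd_cons, hω.eq, hred.eq, List.length_cons]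

theorem exists_longest_mem_parabolic [Finite W] (cs : CoxeterSystem M W) (J : Set B) :
    ∃ w ∈ cs.parabolic J, ∀ i ∈ J, cs.IsLeftDescent w i := by
  obtain ⟨w, hw, hmax⟩ := (Set.toFinite (cs.parabolic J)).exists_maximalFor cs.length _
    ⟨1, cs.one_mem_parabolic J⟩
  refine ⟨w, hw, fun i hi => ?_⟩
  by_contra hd
  rw [not_isLeftDescent_iff] at hd
  have := hmax (cs.simple_mul_mem_parabolic hi hw) (by omega)
  omega

open Relation in
theorem WeakLE.reflTransGen {cs : CoxeterSystem M W} {p : W → Prop}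
    (hp : ∀ x y, cs.WeakLE x y → p y → p x) {x y : W} (h : cs.WeakLE x y) (hy : p y) :
    ReflTransGen (fun a b => (∃ i, b = a * cs.simple i) ∧ cs.WeakLE a b ∧ p b) x y := by
  obtain ⟨ω, hω, hr⟩ := cs.exists_isReduced (x⁻¹ * y)
  obtain rfl : y = x * cs.wordProd ω := by rw [← hr, mul_inv_cancel_left]
  clear hr
  induction ω generalizing x with
  | nil => simpa using ReflTransGen.refl
  | cons i ω ih =>
    have hred : cs.IsReduced ω := hω.drop 1
    have hle : cs.WeakLE (cs.simple i) (x⁻¹ * (x * cs.wordProd (i :: ω))) := by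
      rw [weakLE_simple_iff, inv_mul_cancel_left, isLeftDescent_iff, hω.eq, wordProd_cons,
        simple_mul_simple_cancel_left, hred.eq, List.length_cons]
    obtain ⟨h1, h2⟩ := h.le_inv_mul_iff.mp hle
    refine ReflTransGen.head ⟨⟨i, rfl⟩, h1, hp _ _ h2 hy⟩ ?_
    rw [wordProd_cons, ← mul_assoc] at h2 hy ⊢
    exact ih hred h2 hy

theorem length_le_of_weakLE (cs : CoxeterSystem M W) {x y : W} (h : cs.WeakLE x y) :
    cs.length x ≤ cs.length y := by
  unfold WeakLE at h
  omega

open Relation in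
/-- In a finite Coxeter group, any two elements have a meet in the weak order. -/
theorem exists_weakLE_meet [Finite W] (cs : CoxeterSystem M W) (u v : W) :
    ∃ z, cs.WeakLE z u ∧ cs.WeakLE z v ∧
      ∀ y, cs.WeakLE y u → cs.WeakLE y v → cs.WeakLE y z := by
  let p : W → Prop := fun x => cs.WeakLE x u ∧ cs.WeakLE x v
  have hp : ∀ x y, cs.WeakLE x y → p y → p x := fun x y h hy => ⟨h.trans hy.1, h.trans hy.2⟩
  let r : W → W → Prop := fun a b => (∃ i, b = a * cs.simple i) ∧ cs.WeakLE a b ∧ p b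
  have wf : WellFounded fun a b => r b a := by
    refine Subrelation.wf ?_ (measure fun x => cs.length u - cs.length x).wf
    rintro b a ⟨⟨i, rfl⟩, h1, h2⟩
    have h3 := cs.length_le_of_weakLE h2.1
    rw [weakLE_mul_iff, length_simple] at h1
    change cs.length u - _ < cs.length u - _
    omega
  have hconf : ∀ x y z, r x y → r x z → ∃ w, ReflTransGen r y w ∧ ReflTransGen r z w := by
    rintro x _ _ ⟨⟨i, rfl⟩, hxi, hi⟩ ⟨⟨j, rfl⟩, hxj, hj⟩
    have hx := hp _ _ hxi hi
    obtain ⟨w, hw, hdesc⟩ := cs.exists_longest_mem_parabolic {i, j}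
    have hle : ∀ q, cs.WeakLE x q → cs.WeakLE (x * cs.simple i) q →
        cs.WeakLE (x * cs.simple j) q → cs.WeakLE x (x * w) ∧ cs.WeakLE (x * w) q := by
      intro q hq hqi hqj
      rw [← hq.le_inv_mul_iff]
      refine cs.weakLE_of_mem_parabolic ?_ hw
      rintro k (rfl | rfl) <;> rw [← weakLE_simple_iff, hq.le_inv_mul_iff] <;> constructor <;>
        assumption
    obtain ⟨hxw, hwu⟩ := hle u hx.1 hi.1 hj.1
    have hwv := (hle v hx.2 hi.2 hj.2).2
    refine ⟨x * w, ?_, ?_⟩ <;> refine WeakLE.reflTransGen hp ?_ ⟨hwu, hwv⟩ <;>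
      refine (hxw.le_inv_mul_iff.mp ?_).2 <;>
      rw [inv_mul_cancel_left, weakLE_simple_iff] <;> exact hdesc _ (by simp)
  obtain ⟨m, hm, hmax⟩ := exists_final_of_locally_confluent wf hconf 1
  have hle : ∀ {x y}, ReflTransGen r x y → p x → cs.WeakLE x y ∧ p y := by
    intro x y h hx
    induction h with
    | refl => exact ⟨by simp [WeakLE], hx⟩
    | tail _ h ih => exact ⟨ih.1.trans h.2.1, h.2.2⟩
  have h1 : p 1 := ⟨cs.weakLE_one _, cs.weakLE_one _⟩
  have hpm := (hle hm h1).2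
  refine ⟨m, hpm.1, hpm.2, fun y hyu hyv => ?_⟩
  exact (hle (hmax y ((cs.weakLE_one y).reflTransGen hp ⟨hyu, hyv⟩)) ⟨hyu, hyv⟩).1

theorem exists_max_additive_weakLE [Finite W] (cs : CoxeterSystem M W) (v u : W) :
    ∃ z, cs.WeakLE v (v * z) ∧ cs.WeakLE z u ∧
      ∀ y, cs.WeakLE v (v * y) → cs.WeakLE y u → cs.WeakLE y z := by
  obtain ⟨w₀, -, hw₀⟩ := cs.exists_longest_mem_parabolic Set.univ
  have htop : ∀ y, cs.WeakLE y w₀ := fun y =>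
    cs.weakLE_of_mem_parabolic hw₀ (cs.mem_parabolic_univ y)
  have hiff : ∀ y, cs.WeakLE v (v * y) ↔ cs.WeakLE y (v⁻¹ * w₀) := fun y => by
    rw [(htop v).le_inv_mul_iff, and_iff_left (htop _)]
  simp only [hiff]
  obtain ⟨z, hzu, hzv, hz⟩ := cs.exists_weakLE_meet u (v⁻¹ * w₀)
  exact ⟨z, hzv, hzu, fun y hy hyu => hz y hyu hy⟩

end WeakOrder

section HeadFactor

variable [Finite W]

/-- The largest left divisor `z` of `u` in the weak order such that `v * z` is reduced. -/
noncomputable def headFactor (cs : CoxeterSystem M W) (v u : W) : W :=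
  (cs.exists_max_additive_weakLE v u).choose

theorem weakLE_mul_headFactor (cs : CoxeterSystem M W) (v u : W) :
    cs.WeakLE v (v * cs.headFactor v u) :=
  (cs.exists_max_additive_weakLE v u).choose_spec.1

theorem headFactor_weakLE (cs : CoxeterSystem M W) (v u : W) :
    cs.WeakLE (cs.headFactor v u) u :=
  (cs.exists_max_additive_weakLE v u).choose_spec.2.1

theorem weakLE_headFactor (cs : CoxeterSystem M W) {v u y : W} (h : cs.WeakLE v (v * y))
    (h' : cs.WeakLE y u) : cs.WeakLE y (cs.headFactor v u) :=
  (cs.exists_max_additive_weakLE v u).choose_spec.2.2 y h h'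

theorem headFactor_mul (cs : CoxeterSystem M W) {v w : W} (h : cs.WeakLE v (v * w)) (u : W) :
    cs.headFactor v (w * cs.headFactor w u) = w * cs.headFactor (v * w) u := by
  set z₁ := cs.headFactor w u
  set z := cs.headFactor (v * w) u
  set y := cs.headFactor v (w * z₁)
  have hw₁ : cs.WeakLE w (w * z₁) := cs.weakLE_mul_headFactor w u
  have key : ∀ x, cs.WeakLE (v * w) (v * w * x) ↔
      cs.WeakLE w (w * x) ∧ cs.WeakLE v (v * (w * x)) := by
    intro x
    have h1 := cs.length_mul_le w x
    have h2 := cs.length_mul_le v (w * x)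
    have h3 := cs.length_mul_le (v * w) x
    simp only [weakLE_mul_iff] at h ⊢
    simp only [mul_assoc] at h1 h2 h3 ⊢
    omega
  obtain ⟨hwz, hvz⟩ := (key z).mp (cs.weakLE_mul_headFactor (v * w) u)
  have hle : ∀ x, cs.WeakLE w (w * x) → cs.WeakLE x u → cs.WeakLE (w * x) (w * z₁) := by
    intro x hx hxu
    have h1 : cs.WeakLE x (w⁻¹ * (w * z₁)) := by
      rw [inv_mul_cancel_left]
      exact cs.weakLE_headFactor hx hxu
    exact (hw₁.le_inv_mul_iff.mp h1).2
  have hwy : cs.WeakLE w y := cs.weakLE_headFactor h hw₁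
  have hy : cs.WeakLE v (v * y) := cs.weakLE_mul_headFactor v _
  have hy' : cs.WeakLE y (w * z₁) := cs.headFactor_weakLE v _
  refine WeakLE.antisymm ?_ (cs.weakLE_headFactor hvz (hle z hwz (cs.headFactor_weakLE _ u)))
  have hyx : y = w * (w⁻¹ * y) := by group
  generalize w⁻¹ * y = x at hyx
  rw [hyx] at hwy hy hy' ⊢
  have hxz₁ : cs.WeakLE x z₁ := by
    have := hw₁.le_inv_mul_iff.mpr ⟨hwy, hy'⟩
    rwa [inv_mul_cancel_left] at this
  have hxz : cs.WeakLE x z :=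
    cs.weakLE_headFactor ((key x).mpr ⟨hwy, hy⟩) (hxz₁.trans (cs.headFactor_weakLE w u))
  refine (hwz.le_inv_mul_iff.mp ?_).2
  rwa [inv_mul_cancel_left]

end HeadFactor

end CoxeterSystem

section Garside

variable (cs : CoxeterSystem M W)

theorem bOf_mul {v w : W} (h : cs.WeakLE v (v * w)) :
    bOf cs v * bOf cs w = bOf cs (v * w) :=
  PresentedMonoid.mk_eq_mk_of_rel ⟨v, w, cs.weakLE_mul_iff.mp h, rfl, rfl⟩

theorem bOf_mul_inv_mul {v w : W} (h : cs.WeakLE v w) :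
    bOf cs v * bOf cs (v⁻¹ * w) = bOf cs w := by
  rw [bOf_mul cs (by rwa [mul_inv_cancel_left]), mul_inv_cancel_left]

theorem BraidMonoid.induction {cs : CoxeterSystem M W} {p : BraidMonoid cs → Prop}
    (one : p 1) (mul : ∀ v x, p x → p (bOf cs v * x)) (x : BraidMonoid cs) : p x := by
  induction x using PresentedMonoid.inductionOn with | _ a
  induction a using FreeMonoid.recOn with
  | one => exact one
  | of_mul v a ih => exact mul v _ ih

theorem bOf_mul_bOf_one (v : W) : bOf cs v * bOf cs 1 = bOf cs v := by
  simpa using bOf_mul cs (v := v) (w := 1) (by simp [CoxeterSystem.WeakLE])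

theorem bOf_one_mul_bOf (v : W) : bOf cs 1 * bOf cs v = bOf cs v := by
  simpa using bOf_mul cs (v := 1) (w := v) (by simp [CoxeterSystem.WeakLE])

/-- The presentation with a generator for each element of `W` makes `bOf cs 1` an idempotent
distinct from `1`; it is central. -/
theorem bOf_one_mul_comm (x : BraidMonoid cs) : bOf cs 1 * x = x * bOf cs 1 := by
  induction x using BraidMonoid.induction with
  | one => simp
  | mul v x ih => rw [mul_assoc, ← ih, ← mul_assoc, ← mul_assoc, bOf_mul_bOf_one, bOf_one_mul_bOf]

theorem mul_bOf_mul_mul_bOf_one (x y : BraidMonoid cs) (v : W) :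
    x * bOf cs v * y * bOf cs 1 = x * bOf cs v * y := by
  rw [mul_assoc _ y, ← bOf_one_mul_comm, ← mul_assoc, mul_assoc x, bOf_mul_bOf_one]

section Cancel

variable [Finite W]

/-- Left multiplication by `v` on pairs made of a head in `W` and a tail in `B⁺`. -/
noncomputable def headTailMul (v : W) : Function.End (W × BraidMonoid cs) := fun p =>
  (v * cs.headFactor v p.1, bOf cs ((cs.headFactor v p.1)⁻¹ * p.1) * p.2)

theorem headTailMul_mul {v w : W} (h : cs.WeakLE v (v * w)) :
    headTailMul cs v * headTailMul cs w = headTailMul cs (v * w) := by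
  funext ⟨u, x⟩
  change (v * cs.headFactor v (w * cs.headFactor w u),
    bOf cs ((cs.headFactor v (w * cs.headFactor w u))⁻¹ * (w * cs.headFactor w u)) *
      (bOf cs ((cs.headFactor w u)⁻¹ * u) * x)) =
    (v * w * cs.headFactor (v * w) u, bOf cs ((cs.headFactor (v * w) u)⁻¹ * u) * x)
  rw [cs.headFactor_mul h]
  set z := cs.headFactor (v * w) u with hz
  set z₁ := cs.headFactor w u
  have hz₁ : cs.WeakLE z₁ u := cs.headFactor_weakLE w u
  have hle : cs.WeakLE z z₁ := by
    have h1 := cs.weakLE_mul_headFactor (v * w) u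
    refine cs.weakLE_headFactor ?_ (cs.headFactor_weakLE _ _)
    have h2 := cs.length_mul_le w z
    have h3 := cs.length_mul_le v (w * z)
    rw [CoxeterSystem.weakLE_mul_iff, ← hz] at h1
    rw [CoxeterSystem.weakLE_mul_iff] at h ⊢
    simp only [mul_assoc] at h1
    omega
  have hgrp : (w * z)⁻¹ * (w * z₁) = z⁻¹ * z₁ := by group
  have hprod : z⁻¹ * z₁ * (z₁⁻¹ * u) = z⁻¹ * u := by group
  have hred : cs.WeakLE (z⁻¹ * z₁) (z⁻¹ * z₁ * (z₁⁻¹ * u)) := by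
    have h2 := hle.trans hz₁
    rw [CoxeterSystem.weakLE_mul_iff, hprod]
    unfold CoxeterSystem.WeakLE at hz₁ h2 hle
    omega
  rw [hgrp, ← mul_assoc v, ← mul_assoc (bOf cs _) (bOf cs _), bOf_mul cs hred, hprod]

/-- The action of `B⁺` on pairs made of a head in `W` and a tail in `B⁺`. -/
noncomputable def headTailAction : BraidMonoid cs →* Function.End (W × BraidMonoid cs) :=
  PresentedMonoid.lift (headTailMul cs) (by
    rintro a b ⟨v, w, h, rfl, rfl⟩
    simpa using headTailMul_mul cs (cs.weakLE_mul_iff.mpr h))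

/-- The largest element of `W` whose lift to `B⁺` left-divides `x`. -/
noncomputable def bHead (x : BraidMonoid cs) : W := (headTailAction cs x (1, bOf cs 1)).1

/-- The cofactor of `bHead cs x`. -/
noncomputable def bTail (x : BraidMonoid cs) : BraidMonoid cs :=
  (headTailAction cs x (1, bOf cs 1)).2

theorem headTailAction_bOf_mul (v : W) (x : BraidMonoid cs) :
    headTailAction cs (bOf cs v * x) (1, bOf cs 1) =
      (v * cs.headFactor v (bHead cs x),
        bOf cs ((cs.headFactor v (bHead cs x))⁻¹ * bHead cs x) * bTail cs x) := by
  rw [map_mul]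
  change headTailAction cs (bOf cs v) (headTailAction cs x (1, bOf cs 1)) = _
  rw [headTailAction, bOf, PresentedMonoid.lift_of]
  rfl

theorem bHead_bOf_mul (v : W) (x : BraidMonoid cs) :
    bHead cs (bOf cs v * x) = v * cs.headFactor v (bHead cs x) :=
  congrArg Prod.fst (headTailAction_bOf_mul cs v x)

theorem bTail_bOf_mul (v : W) (x : BraidMonoid cs) :
    bTail cs (bOf cs v * x) =
      bOf cs ((cs.headFactor v (bHead cs x))⁻¹ * bHead cs x) * bTail cs x :=
  congrArg Prod.snd (headTailAction_bOf_mul cs v x)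

theorem bHead_mul_bTail (x : BraidMonoid cs) :
    bOf cs (bHead cs x) * bTail cs x = x * bOf cs 1 := by
  induction x using BraidMonoid.induction with
  | one =>
    rw [bHead, bTail, map_one]
    change bOf cs 1 * bOf cs 1 = _
    rw [bOf_mul_bOf_one, one_mul]
  | mul v x ih =>
    rw [bHead_bOf_mul, bTail_bOf_mul, ← bOf_mul cs (cs.weakLE_mul_headFactor _ _), ← mul_assoc,
      mul_assoc (bOf cs v), bOf_mul_inv_mul cs (cs.headFactor_weakLE _ _), mul_assoc, ih, mul_assoc]

theorem weakLE_bHead_bOf_mul (v : W) (x : BraidMonoid cs) :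
    cs.WeakLE v (bHead cs (bOf cs v * x)) := by
  rw [bHead_bOf_mul]
  exact cs.weakLE_mul_headFactor _ _

theorem mul_bOf_one_eq_of_bOf_mul (v : W) (x : BraidMonoid cs) :
    x * bOf cs 1 = bOf cs (v⁻¹ * bHead cs (bOf cs v * x)) * bTail cs (bOf cs v * x) := by
  rw [bHead_bOf_mul, bTail_bOf_mul, inv_mul_cancel_left, ← mul_assoc,
    bOf_mul_inv_mul cs (cs.headFactor_weakLE _ _), bHead_mul_bTail]

/-- Left cancellation, up to the idempotent `bOf cs 1`. -/
theorem mul_bOf_one_left_cancel {a x y : BraidMonoid cs} (h : a * x = a * y) :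
    x * bOf cs 1 = y * bOf cs 1 := by
  induction a using BraidMonoid.induction generalizing x y with
  | one => simpa using congrArg (· * bOf cs 1) h
  | mul v a ih =>
    rw [mul_assoc, mul_assoc] at h
    have h1 := mul_bOf_one_eq_of_bOf_mul cs v (a * x)
    rw [h, ← mul_bOf_one_eq_of_bOf_mul, mul_assoc, mul_assoc] at h1
    simpa only [mul_assoc, bOf_mul_bOf_one] using ih h1

/-- If `c * 𝐬ᵢ` left-divides `b` for all `i ∈ J`, then so does `c * 𝐰` for all `w` with
a reduced expression in `J`. -/
theorem mul_bOf_dvd_of_forall_simple {J : Set B} (hJ : J.Nonempty) {c b : BraidMonoid cs} {w : W}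
    (hw : w ∈ cs.parabolic J) (h : ∀ i ∈ J, ∃ z, c * bOf cs (cs.simple i) * z = b) :
    ∃ z, c * bOf cs w * z = b := by
  obtain ⟨i, hi⟩ := hJ
  obtain ⟨y, rfl⟩ := h i hi
  set b' := bOf cs (cs.simple i) * y
  have hb' : b' * bOf cs 1 = b' := by
    simpa using mul_bOf_mul_mul_bOf_one cs 1 y (cs.simple i)
  have hdesc : ∀ j ∈ J, cs.IsLeftDescent (bHead cs b') j := by
    intro j hj
    obtain ⟨x, hx⟩ := h j hj
    rw [mul_assoc, mul_assoc] at hx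
    have := mul_bOf_one_left_cancel cs hx
    rw [hb', mul_assoc] at this
    rw [← cs.weakLE_simple_iff, ← this]
    exact weakLE_bHead_bOf_mul cs _ _
  refine ⟨bOf cs (w⁻¹ * bHead cs b') * bTail cs b', ?_⟩
  rw [mul_assoc c, ← mul_assoc (bOf cs w), bOf_mul_inv_mul cs (cs.weakLE_of_mem_parabolic hdesc hw),
    bHead_mul_bTail, hb', mul_assoc]

end Cancel

theorem bOf_wordProd_mem_bSub {J : Set B} {ω : List B} (hω : cs.IsReduced ω) (hne : ω ≠ [])
    (hJ : ∀ i ∈ ω, i ∈ J) : bOf cs (cs.wordProd ω) ∈ bSub cs J := by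
  induction ω with
  | nil => exact absurd rfl hne
  | cons i ω ih =>
    have hi : bOf cs (cs.simple i) ∈ bSub cs J :=
      Submonoid.subset_closure ⟨i, hJ i List.mem_cons_self, rfl⟩
    rcases eq_or_ne ω [] with rfl | hω0
    · simpa using hi
    · have hred : cs.IsReduced ω := hω.drop 1
      rw [cs.wordProd_cons, ← bOf_mul cs]
      · exact mul_mem hi (ih hred hω0 fun k hk => hJ k (List.mem_cons_of_mem _ hk))
      · rw [cs.weakLE_mul_iff, ← cs.wordProd_cons, hω.eq, hred.eq, cs.length_simple,
          List.length_cons, add_comm]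

theorem bOf_simple_mul_eq {J : Set B} {w : W} {i : B} (hi : i ∈ J) (hw : w ∈ cs.parabolic J)
    (hd : cs.IsLeftDescent w i) : ∃ d ∈ bSub cs J, bOf cs (cs.simple i) * d = bOf cs w := by
  obtain ⟨ω, hJ, hω, hprod⟩ := cs.simple_mul_mem_parabolic hi hw
  rcases eq_or_ne ω [] with rfl | hne
  · refine ⟨1, one_mem _, ?_⟩
    rw [mul_one, ← cs.simple_mul_simple_cancel_left (w := w) i, ← hprod, cs.wordProd_nil, mul_one]
  · refine ⟨_, bOf_wordProd_mem_bSub cs hω hne hJ, ?_⟩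
    have := bOf_mul_inv_mul cs (cs.weakLE_simple_iff.mpr hd)
    rwa [cs.inv_simple, ← hprod] at this

theorem bLen_bOf (v : W) : (bLen cs (bOf cs v)).toAdd = cs.length v := rfl

theorem eq_one_or_eq_bOf_one_of_bLen_eq_zero (x : BraidMonoid cs) (h : (bLen cs x).toAdd = 0) :
    x = 1 ∨ x = bOf cs 1 := by
  induction x using BraidMonoid.induction with
  | one => exact .inl rfl
  | mul v x ih =>
    rw [map_mul, toAdd_mul, bLen_bOf, Nat.add_eq_zero_iff, cs.length_eq_zero_iff] at h
    obtain ⟨rfl, hx⟩ := h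
    rcases ih hx with rfl | rfl
    · exact .inr (mul_one _)
    · exact .inr (bOf_mul_bOf_one cs 1)

theorem eq_one_or_mul_bOf_one_eq_of_mem_bSub {J : Set B} {c : BraidMonoid cs}
    (hc : c ∈ bSub cs J) : c = 1 ∨ c * bOf cs 1 = c ∧ (bLen cs c).toAdd ≠ 0 := by
  induction hc using Submonoid.closure_induction with
  | mem x hx =>
    obtain ⟨i, -, rfl⟩ := hx
    exact .inr ⟨bOf_mul_bOf_one cs _, by simp [bLen_bOf]⟩
  | one => exact .inl rfl
  | mul x y _ _ hx hy =>
    rcases hy with rfl | ⟨hy, hy'⟩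
    · simpa using hx
    · refine .inr ⟨by rw [mul_assoc, hy], ?_⟩
      rw [map_mul, toAdd_mul]
      omega

theorem eq_of_mem_bSub_of_dvd_of_dvd {J : Set B} {a c : BraidMonoid cs} (ha : a ∈ bSub cs J)
    (hac : ∃ z, a * z = c) (hca : ∃ z, c * z = a) (hc : c ∈ bSub cs J) : a = c := by
  obtain ⟨x, rfl⟩ := hac
  obtain ⟨y, hy⟩ := hca
  have hlen := congrArg (fun b => (bLen cs b).toAdd) hy
  simp only [map_mul, toAdd_mul] at hlen
  rcases eq_one_or_eq_bOf_one_of_bLen_eq_zero cs x (by omega) with rfl | rfl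
  · rw [mul_one]
  · rcases eq_one_or_mul_bOf_one_eq_of_mem_bSub cs ha with rfl | ⟨h, -⟩
    · rcases eq_one_or_mul_bOf_one_eq_of_mem_bSub cs hc with h | ⟨-, h⟩
      · exact h.symm
      · simp [bLen_bOf] at h
    · exact h.symm

/-- One step of the growth of left divisors of `b`: the new one arises from the old one by right
multiplication by a generator in `I`. -/
def DivisorStep (I : Set B) (b c c' : BraidMonoid cs) : Prop :=
  (∃ i ∈ I, c' = c * bOf cs (cs.simple i)) ∧ ∃ z, c' * z = b

open Relation

theorem reflTransGen_divisorStep_of_mem_bSub {I : Set B} {b d : BraidMonoid cs}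
    (hd : d ∈ bSub cs I) (c : BraidMonoid cs) (h : ∃ z, c * d * z = b) :
    ReflTransGen (DivisorStep cs I b) c (c * d) := by
  induction hd using Submonoid.closure_induction generalizing c with
  | mem x hx =>
    obtain ⟨i, hi, rfl⟩ := hx
    exact .single ⟨⟨i, hi, rfl⟩, h⟩
  | one => simpa using ReflTransGen.refl
  | mul x y _ _ hx hy =>
    rw [← mul_assoc] at h ⊢
    obtain ⟨z, hz⟩ := h
    exact (hx c ⟨y * z, by rw [← hz, mul_assoc _ y]⟩).trans (hy _ ⟨z, hz⟩)

theorem exists_mul_eq_of_reflTransGen_divisorStep {I : Set B} {b c c' : BraidMonoid cs}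
    (h : ReflTransGen (DivisorStep cs I b) c c') : ∃ d ∈ bSub cs I, c * d = c' := by
  induction h with
  | refl => exact ⟨1, one_mem _, mul_one _⟩
  | tail _ h ih =>
    obtain ⟨d, hd, rfl⟩ := ih
    obtain ⟨⟨i, hi, rfl⟩, -⟩ := h
    exact ⟨d * bOf cs (cs.simple i), mul_mem hd (Submonoid.subset_closure ⟨i, hi, rfl⟩),
      (mul_assoc ..).symm⟩

theorem bSub_mono {I J : Set B} (h : I ⊆ J) : bSub cs I ≤ bSub cs J :=
  Submonoid.closure_mono (Set.image_mono h)

theorem wellFounded_divisorStep (I : Set B) (b : BraidMonoid cs) :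
    WellFounded fun c c' => DivisorStep cs I b c' c := by
  refine Subrelation.wf ?_
    (measure fun x : BraidMonoid cs => (bLen cs b).toAdd - (bLen cs x).toAdd).wf
  rintro _ c ⟨⟨i, -, rfl⟩, z, rfl⟩
  change (_ : ℕ) - _ < _ - _
  simp only [map_mul, toAdd_mul, bLen_bOf, cs.length_simple]
  omega

theorem divisorStep_locally_confluent [Finite W] (I : Set B) (b x y z : BraidMonoid cs)
    (hy : DivisorStep cs I b x y) (hz : DivisorStep cs I b x z) :
    ∃ w, ReflTransGen (DivisorStep cs I b) y w ∧ ReflTransGen (DivisorStep cs I b) z w := by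
  obtain ⟨⟨i, hi, rfl⟩, hib⟩ := hy
  obtain ⟨⟨j, hj, rfl⟩, hjb⟩ := hz
  obtain ⟨w, hw, hdesc⟩ := cs.exists_longest_mem_parabolic {i, j}
  have hdvd : ∃ z, x * bOf cs w * z = b :=
    mul_bOf_dvd_of_forall_simple cs ⟨i, by simp⟩ hw (by rintro k (rfl | rfl) <;> assumption)
  have hstep : ∀ k ∈ ({i, j} : Set B),
      ReflTransGen (DivisorStep cs I b) (x * bOf cs (cs.simple k)) (x * bOf cs w) := by
    intro k hk
    obtain ⟨d, hd, hdw⟩ := bOf_simple_mul_eq cs hk hw (hdesc k hk)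
    have hdI : d ∈ bSub cs I := bSub_mono cs (by rintro l (rfl | rfl) <;> assumption) hd
    rw [← hdw, ← mul_assoc] at hdvd ⊢
    exact reflTransGen_divisorStep_of_mem_bSub cs hdI _ hdvd
  exact ⟨_, hstep i (by simp), hstep j (by simp)⟩

end Garside

/-- For every `I ⊆ S`, every element `b` of `B⁺` has a unique maximal
left divisor belonging to `B⁺_I`. -/
theorem stmt8 [Finite W] (cs : CoxeterSystem M W) (I : Set B) (b : BraidMonoid cs) :
    ∃! a : BraidMonoid cs, a ∈ bSub cs I ∧ (∃ z, a * z = b) ∧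
      ∀ c ∈ bSub cs I, (∃ z, c * z = b) → ∃ z, c * z = a := by
  obtain ⟨a, ha, hmax⟩ := exists_final_of_locally_confluent (wellFounded_divisorStep cs I b)
    (divisorStep_locally_confluent cs I b) 1
  have haI : a ∈ bSub cs I := by
    obtain ⟨d, hd, rfl⟩ := exists_mul_eq_of_reflTransGen_divisorStep cs ha
    rwa [one_mul]
  have hab : ∃ z, a * z = b := by
    rcases Relation.ReflTransGen.cases_tail ha with rfl | ⟨c, -, -, h⟩
    · exact ⟨b, one_mul b⟩
    · exact h
  have hac : ∀ c ∈ bSub cs I, (∃ z, c * z = b) → ∃ z, c * z = a := by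
    intro c hc hcb
    have h := reflTransGen_divisorStep_of_mem_bSub cs hc 1 (by simpa using hcb)
    rw [one_mul] at h
    obtain ⟨d, -, hd⟩ := exists_mul_eq_of_reflTransGen_divisorStep cs (hmax c h)
    exact ⟨d, hd⟩
  refine ⟨a, ⟨haI, hab, hac⟩, ?_⟩
  rintro a' ⟨ha'I, ha'b, ha'⟩
  exact eq_of_mem_bSub_of_dvd_of_dvd cs ha'I (hac a' ha'I ha'b) (ha' a haI hab) haI
end

section
/- Let w ∈ B⁺ and s ∈ S, and suppose there exists b ∈ B⁺ with w·𝐬 = b·w in B⁺. Let w = w₁⋯w_k be the normal form of w. Then for every 1 ≤ i ≤ k there exists t ∈ S with (w_i·w_{i+1}⋯w_k)·𝐬 = 𝐭·(w_i·w_{i+1}⋯w_k) in B⁺. -/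
/-!
Artin–Tits braid monoid of a finite Coxeter system `(W,S)`, presented with one
generator `𝐰` for each `w ∈ W` and relations `𝐰₁𝐰₂ = 𝐰` when `w = w₁w₂` with
`l(w₁) + l(w₂) = l(w)`.
-/

variable {B : Type*} {W : Type*} [Group W] {M : CoxeterMatrix B}

namespace CoxeterSystem

variable (cs : CoxeterSystem M W)

open Classical in
/-- The action of the simple reflection `s` on signed group elements: `(t, ε)` is sent to `sts`,
with the sign changed exactly when `t = s`. -/
noncomputable def signedConj (i : B) : Function.End (W × ZMod 2) := fun p =>
  (cs.simple i * p.1 * cs.simple i, p.2 + if p.1 = cs.simple i then 1 else 0)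

lemma simple_mul_simple_pow_inv (i i' : B) (n : ℕ) :
    ((cs.simple i * cs.simple i') ^ n)⁻¹ = (cs.simple i' * cs.simple i) ^ n := by
  rw [← inv_pow]; simp

lemma simple_mul_simple_mul_pow (i i' : B) (n : ℕ) :
    cs.simple i' * (cs.simple i * cs.simple i') ^ n =
      (cs.simple i' * cs.simple i) ^ n * cs.simple i' :=
  (SemiconjBy.pow_right (by simp [SemiconjBy, mul_assoc]) n : SemiconjBy _ _ _)

open Classical in
lemma signedConj_mul_pow_apply (i i' : B) (n : ℕ) (p : W × ZMod 2) :
    ((cs.signedConj i * cs.signedConj i') ^ n) p =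
      ((cs.simple i * cs.simple i') ^ n * p.1 * (cs.simple i' * cs.simple i) ^ n,
        p.2 + ∑ j ∈ Finset.range (2 * n),
          if p.1 = (cs.simple i' * cs.simple i) ^ j * cs.simple i' then 1 else 0) := by
  induction n with
  | zero => simp; rfl
  | succ n ih =>
    have h₁ : (cs.simple i * cs.simple i') ^ n * p.1 * (cs.simple i' * cs.simple i) ^ n =
        cs.simple i' ↔ p.1 = (cs.simple i' * cs.simple i) ^ (2 * n) * cs.simple i' := by
      rw [← simple_mul_simple_pow_inv cs i i', mul_inv_eq_iff_eq_mul, ← eq_inv_mul_iff_mul_eq,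
        simple_mul_simple_pow_inv, simple_mul_simple_mul_pow, ← mul_assoc, ← pow_add, two_mul]
    have h₂ : cs.simple i' * ((cs.simple i * cs.simple i') ^ n * p.1 *
          (cs.simple i' * cs.simple i) ^ n) * cs.simple i' = cs.simple i ↔
        p.1 = (cs.simple i' * cs.simple i) ^ (2 * n + 1) * cs.simple i' := by
      have : cs.simple i' * ((cs.simple i * cs.simple i') ^ n * p.1 *
          (cs.simple i' * cs.simple i) ^ n) * cs.simple i' = cs.simple i ↔
          (cs.simple i * cs.simple i') ^ n * p.1 * (cs.simple i' * cs.simple i) ^ n =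
            cs.simple i' * cs.simple i * cs.simple i' := by
        generalize (cs.simple i * cs.simple i') ^ n * p.1 * (cs.simple i' * cs.simple i) ^ n = q
        constructor
        · rintro h
          simp [← h, mul_assoc]
        · rintro rfl
          simp [mul_assoc]
      rw [this, ← simple_mul_simple_pow_inv cs i i', mul_inv_eq_iff_eq_mul,
        ← eq_inv_mul_iff_mul_eq, simple_mul_simple_pow_inv, mul_assoc _ (cs.simple i'),
        simple_mul_simple_mul_pow, show 2 * n + 1 = n + (1 + n) by ring, pow_add, pow_add, pow_one]
      simp only [mul_assoc]
    rw [pow_succ']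
    change cs.signedConj i (cs.signedConj i' (((cs.signedConj i * cs.signedConj i') ^ n) p)) = _
    rw [ih, show 2 * (n + 1) = 2 * n + 1 + 1 by ring, Finset.sum_range_succ,
      Finset.sum_range_succ]
    simp only [signedConj, h₁, h₂]
    refine Prod.ext ?_ (by simp only [add_assoc])
    simp only [pow_succ' (cs.simple i * cs.simple i'), pow_succ (cs.simple i' * cs.simple i),
      mul_assoc]

lemma signedConj_isLiftable : M.IsLiftable cs.signedConj := by
  classical
  intro i i'
  funext p
  rw [signedConj_mul_pow_apply, two_mul, Finset.sum_range_add]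
  simp only [pow_add, simple_mul_simple_pow, simple_mul_simple_pow', one_mul, mul_one,
    CharTwo.add_self_eq_zero, add_zero]
  rfl

/-- The action of `W` on signed group elements extending `signedConj`. -/
noncomputable def signedConjHom : W →* Function.End (W × ZMod 2) :=
  cs.lift ⟨cs.signedConj, cs.signedConj_isLiftable⟩

open Classical in
lemma signedConjHom_simple_mul (i : B) (w : W) (p : W × ZMod 2) :
    cs.signedConjHom (cs.simple i * w) p =
      (cs.simple i * (cs.signedConjHom w p).1 * cs.simple i,
        (cs.signedConjHom w p).2 +
          if (cs.signedConjHom w p).1 = cs.simple i then 1 else 0) := by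
  rw [map_mul, signedConjHom, lift_apply_simple]
  rfl

lemma signedConjHom_fst (w : W) (p : W × ZMod 2) :
    (cs.signedConjHom w p).1 = w * p.1 * w⁻¹ := by
  induction w using cs.simple_induction_left with
  | one => simp; rfl
  | mul_simple_left w i ih => rw [signedConjHom_simple_mul, ih]; simp [mul_assoc]

/-- If right multiplication by `t` changes the sign of `t` under the word `ω`, then the product of
`ω` with `t` is obtained by deleting a letter. -/
lemma exists_sublist_of_signedConjHom_ne {ω : List B} {t : W}
    (h : (cs.signedConjHom (cs.wordProd ω) (t, 0)).2 ≠ 0) :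
    ∃ ν : List B, ν.Sublist ω ∧ ν.length + 1 = ω.length ∧
      cs.wordProd ω * t = cs.wordProd ν := by
  classical
  induction ω with
  | nil => exact absurd (by simp; rfl) h
  | cons i ω ih =>
    rw [wordProd_cons, signedConjHom_simple_mul, signedConjHom_fst] at h
    by_cases hi : cs.wordProd ω * t * (cs.wordProd ω)⁻¹ = cs.simple i
    · refine ⟨ω, List.sublist_cons_self _ _, rfl, ?_⟩
      rw [mul_inv_eq_iff_eq_mul] at hi
      rw [wordProd_cons, mul_assoc, hi, simple_mul_simple_cancel_left]
    · rw [if_neg hi, add_zero] at h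
      obtain ⟨ν, h₁, h₂, h₃⟩ := ih h
      refine ⟨i :: ν, h₁.cons_cons i, by simp [h₂], ?_⟩
      rw [wordProd_cons, wordProd_cons, mul_assoc, h₃]

/-- The exchange condition, on the right. -/
theorem exchange_right {ω : List B} {i : B} (h : cs.IsRightDescent (cs.wordProd ω) i) :
    ∃ ν : List B, ν.Sublist ω ∧ ν.length + 1 = ω.length ∧
      cs.wordProd ω * cs.simple i = cs.wordProd ν := by
  classical
  refine cs.exists_sublist_of_signedConjHom_ne fun h0 => ?_
  obtain ⟨ν, hν, hw⟩ := cs.exists_isReduced (cs.wordProd ω * cs.simple i)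
  have key : (cs.signedConjHom (cs.wordProd ν) (cs.simple i, 0)).2 ≠ 0 := by
    have hadd : ∀ (w : W) (t : W) (e : ZMod 2),
        (cs.signedConjHom w (t, e)).2 = (cs.signedConjHom w (t, 0)).2 + e := by
      intro w t e
      induction w using cs.simple_induction_left with
      | one => rw [map_one]; exact (zero_add e).symm
      | mul_simple_left w j ih =>
        rw [signedConjHom_simple_mul, signedConjHom_simple_mul, signedConjHom_fst,
          signedConjHom_fst, ih]
        ring
    have hs : cs.signedConjHom (cs.simple i) (cs.simple i, 0) = (cs.simple i, 1) := by
      have := cs.signedConjHom_simple_mul i 1 (cs.simple i, 0)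
      rw [mul_one, map_one] at this
      rw [this]
      change (cs.simple i * cs.simple i * cs.simple i,
        0 + if cs.simple i = cs.simple i then (1 : ZMod 2) else 0) = _
      simp
    rw [← hw, map_mul]
    change (cs.signedConjHom (cs.wordProd ω) (cs.signedConjHom (cs.simple i) _)).2 ≠ 0
    rw [hs, hadd, h0]
    decide
  obtain ⟨μ, -, hlen, hμ⟩ := cs.exists_sublist_of_signedConjHom_ne key
  rw [← hw, simple_mul_simple_cancel_right] at hμ
  have h₁ := cs.length_wordProd_le μ
  have h₂ := hν.eq
  rw [← hw] at h₂
  rw [← hμ] at h₁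
  unfold IsRightDescent at h
  omega

/-- The exchange condition, on the left. -/
theorem exchange_left {ω : List B} {i : B} (h : cs.IsLeftDescent (cs.wordProd ω) i) :
    ∃ ν : List B, ν.Sublist ω ∧ ν.length + 1 = ω.length ∧
      cs.simple i * cs.wordProd ω = cs.wordProd ν := by
  rw [← isRightDescent_inv_iff, ← wordProd_reverse] at h
  obtain ⟨ν, h₁, h₂, h₃⟩ := cs.exchange_right h
  refine ⟨ν.reverse, List.reverse_sublist.1 (by simpa using h₁), by simpa using h₂, ?_⟩
  rw [wordProd_reverse, ← h₃]
  simp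

/-- The product `xy` is length-additive. -/
def LengthAdditive (x y : W) : Prop := cs.length (x * y) = cs.length x + cs.length y

/-- `x` is a prefix of `y` : the order relation of the right weak order. -/
def IsPrefix (x y : W) : Prop := cs.LengthAdditive x (x⁻¹ * y)

variable {cs}

lemma LengthAdditive.assoc_right {x y z : W} (h₁ : cs.LengthAdditive x y)
    (h₂ : cs.LengthAdditive (x * y) z) : cs.LengthAdditive y z ∧ cs.LengthAdditive x (y * z) := by
  have h₃ := cs.length_mul_le x (y * z)
  have h₄ := cs.length_mul_le y z
  unfold LengthAdditive at *
  rw [mul_assoc] at h₂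
  omega

lemma LengthAdditive.assoc_left {x y z : W} (h₁ : cs.LengthAdditive y z)
    (h₂ : cs.LengthAdditive x (y * z)) :
    cs.LengthAdditive x y ∧ cs.LengthAdditive (x * y) z := by
  have h₃ := cs.length_mul_le (x * y) z
  have h₄ := cs.length_mul_le x y
  unfold LengthAdditive at *
  rw [← mul_assoc] at h₂
  omega

lemma LengthAdditive.inv {x y : W} (h : cs.LengthAdditive x y) :
    cs.LengthAdditive y⁻¹ x⁻¹ := by
  unfold LengthAdditive at *
  rw [← mul_inv_rev, length_inv, length_inv, length_inv, h, add_comm]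

variable (cs) in
lemma lengthAdditive_one_right (x : W) : cs.LengthAdditive x 1 := by simp [LengthAdditive]

variable (cs) in
lemma isPrefix_refl (x : W) : cs.IsPrefix x x := by simp [IsPrefix, LengthAdditive]

lemma LengthAdditive.isPrefix {x y : W} (h : cs.LengthAdditive x y) : cs.IsPrefix x (x * y) := by
  simpa [IsPrefix] using h

lemma IsPrefix.exists_eq_mul {x y : W} (h : cs.IsPrefix x y) :
    ∃ z, cs.LengthAdditive x z ∧ y = x * z := ⟨x⁻¹ * y, h, by simp⟩

lemma IsPrefix.trans {x y z : W} (h₁ : cs.IsPrefix x y) (h₂ : cs.IsPrefix y z) :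
    cs.IsPrefix x z := by
  obtain ⟨u, hu, rfl⟩ := h₁.exists_eq_mul
  obtain ⟨v, hv, rfl⟩ := h₂.exists_eq_mul
  rw [mul_assoc]
  exact (hu.assoc_right hv).2.isPrefix

lemma IsPrefix.length_le {x y : W} (h : cs.IsPrefix x y) : cs.length x ≤ cs.length y := by
  obtain ⟨u, hu, rfl⟩ := h.exists_eq_mul
  unfold LengthAdditive at hu
  omega

lemma IsPrefix.antisymm {x y : W} (h₁ : cs.IsPrefix x y) (h₂ : cs.IsPrefix y x) : x = y := by
  have h := h₂.length_le
  obtain ⟨u, hu, rfl⟩ := h₁.exists_eq_mul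
  unfold LengthAdditive at hu
  have : u = 1 := cs.length_eq_zero_iff.1 (by omega)
  simp [this]

lemma LengthAdditive.of_isPrefix {x y z : W} (h : cs.LengthAdditive x z) (hy : cs.IsPrefix y z) :
    cs.LengthAdditive x y := by
  obtain ⟨u, hu, rfl⟩ := hy.exists_eq_mul
  exact (hu.assoc_left h).1

lemma IsPrefix.mul_left {x y z : W} (h : cs.IsPrefix x y) (hy : cs.LengthAdditive z y) :
    cs.IsPrefix (z * x) (z * y) := by
  obtain ⟨u, hu, rfl⟩ := h.exists_eq_mul
  rw [← mul_assoc]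
  exact (hu.assoc_left hy).2.isPrefix

lemma IsPrefix.of_mul_left {x y z : W} (h : cs.IsPrefix (z * x) (z * y))
    (hx : cs.LengthAdditive z x) : cs.IsPrefix x y := by
  obtain ⟨u, hu, hy⟩ := h.exists_eq_mul
  rw [mul_assoc, mul_left_cancel_iff] at hy
  rw [hy]
  exact (hx.assoc_right hu).1.isPrefix

lemma isPrefix_simple_iff {i : B} {w : W} :
    cs.IsPrefix (cs.simple i) w ↔ cs.IsLeftDescent w i := by
  rw [IsPrefix, LengthAdditive, isLeftDescent_iff, inv_simple, simple_mul_simple_cancel_left,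
    length_simple]
  omega

lemma lengthAdditive_simple_iff {i : B} {w : W} :
    cs.LengthAdditive w (cs.simple i) ↔ ¬ cs.IsRightDescent w i := by
  rw [LengthAdditive, not_isRightDescent_iff, length_simple]

variable (cs)

/-- `v` has minimal length in its coset `W_I v`. -/
def IsCosetMin (I : Set B) (v : W) : Prop :=
  ∀ ω : List B, (∀ i ∈ ω, i ∈ I) → cs.length v ≤ cs.length (cs.wordProd ω * v)

lemma exists_eq_mul_isCosetMin (I : Set B) (u : W) :
    ∃ (ω : List B) (v : W), (∀ i ∈ ω, i ∈ I) ∧ cs.IsCosetMin I v ∧ u = cs.wordProd ω * v := by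
  classical
  have hex : ∃ n, ∃ ω : List B, (∀ i ∈ ω, i ∈ I) ∧ cs.length (cs.wordProd ω * u) = n :=
    ⟨_, [], by simp, rfl⟩
  obtain ⟨ω, hω, hn⟩ := Nat.find_spec hex
  refine ⟨ω.reverse, cs.wordProd ω * u, by simpa using hω, fun ν hν => ?_, by simp⟩
  rw [hn, ← mul_assoc, ← wordProd_append]
  exact Nat.find_min' hex ⟨ν ++ ω, by simpa [or_imp, forall_and] using ⟨hν, hω⟩, rfl⟩

/-- Words with letters in `I` may be shortened without leaving `I`. -/
lemma exists_minimal_word (I : Set B) (ω : List B) (hω : ∀ i ∈ ω, i ∈ I) :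
    ∃ ν : List B, (∀ i ∈ ν, i ∈ I) ∧ cs.wordProd ν = cs.wordProd ω ∧
      ∀ μ : List B, (∀ i ∈ μ, i ∈ I) → cs.wordProd μ = cs.wordProd ν → ν.length ≤ μ.length := by
  classical
  have hex : ∃ n, ∃ ν : List B, (∀ i ∈ ν, i ∈ I) ∧ cs.wordProd ν = cs.wordProd ω ∧
      ν.length = n := ⟨_, ω, hω, rfl, rfl⟩
  obtain ⟨ν, hν, hp, hn⟩ := Nat.find_spec hex
  refine ⟨ν, hν, hp, fun μ hμ h => ?_⟩
  rw [hn]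
  exact Nat.find_min' hex ⟨μ, hμ, h.trans hp, rfl⟩

variable {cs}

lemma IsCosetMin.length_wordProd_mul {I : Set B} {v : W} (hv : cs.IsCosetMin I v) {ω : List B}
    (hω : ∀ i ∈ ω, i ∈ I) (hmin : ∀ μ : List B, (∀ i ∈ μ, i ∈ I) →
      cs.wordProd μ = cs.wordProd ω → ω.length ≤ μ.length) :
    cs.length (cs.wordProd ω * v) = ω.length + cs.length v := by
  induction ω with
  | nil => simp
  | cons i ω ih =>
    have hi : i ∈ I := hω i (by simp)
    have hω' : ∀ j ∈ ω, j ∈ I := fun j hj => hω j (by simp [hj])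
    have ih' := ih hω' fun μ hμ h => by
      have := hmin (i :: μ) (by simpa using ⟨hi, hμ⟩) (by rw [wordProd_cons, wordProd_cons, h])
      simpa using this
    rw [wordProd_cons, mul_assoc]
    rcases cs.length_simple_mul (cs.wordProd ω * v) i with h | h
    · rw [h, ih', List.length_cons]; ring
    · exfalso
      obtain ⟨ρ, hρ, rfl⟩ := cs.exists_isReduced v
      rw [← wordProd_append] at h ih'
      obtain ⟨ν, hsub, hlen, hprod⟩ := cs.exchange_left
        (show cs.IsLeftDescent (cs.wordProd (ω ++ ρ)) i by unfold IsLeftDescent; omega)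
      obtain ⟨ν₁, ν₂, rfl, h₁, h₂⟩ := List.sublist_append_iff.1 hsub
      rw [List.length_append, List.length_append] at hlen
      have hν₁ : ∀ j ∈ ν₁, j ∈ I := fun j hj => hω' j (h₁.subset hj)
      have hle := h₁.length_le
      rcases h₂.length_le.lt_or_eq with h₂' | h₂'
      · have h₁' : ν₁ = ω := h₁.eq_of_length (by omega)
        subst h₁'
        have := hv (ν₁.reverse ++ i :: ν₁) (by
          intro j hj
          simp only [List.mem_append, List.mem_reverse, List.mem_cons] at hj
          rcases hj with hj | rfl | hj
          exacts [hν₁ j hj, hi, hν₁ j hj])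
        rw [wordProd_append, wordProd_append, ← mul_assoc] at hprod
        rw [wordProd_append, wordProd_cons, mul_assoc, hprod, wordProd_reverse,
          inv_mul_cancel_left, hρ.eq] at this
        have := cs.length_wordProd_le ν₂
        omega
      · have h₂'' : ν₂ = ρ := h₂.eq_of_length h₂'
        subst h₂''
        rw [wordProd_append, wordProd_append, ← mul_assoc, mul_left_inj] at hprod
        have := hmin ν₁ hν₁ (by rw [wordProd_cons, hprod])
        simp only [List.length_cons] at this
        omega

lemma IsCosetMin.lengthAdditive {I : Set B} {v : W} (hv : cs.IsCosetMin I v) {ω : List B}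
    (hω : ∀ i ∈ ω, i ∈ I) : cs.LengthAdditive (cs.wordProd ω) v := by
  obtain ⟨ν, hν, hp, hmin⟩ := cs.exists_minimal_word I ω hω
  have h₁ := hv.length_wordProd_mul hν hmin
  have h₂ := IsCosetMin.length_wordProd_mul (cs := cs) (v := 1) (fun _ _ => by simp) hν hmin
  rw [mul_one, length_one, add_zero] at h₂
  rw [LengthAdditive, ← hp, h₁, h₂]

/-- An element without left descents in `I` is minimal in its coset. -/
lemma isCosetMin_of_not_isLeftDescent {I : Set B} {v : W}
    (h : ∀ i ∈ I, ¬ cs.IsLeftDescent v i) : cs.IsCosetMin I v := by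
  obtain ⟨ω, v₀, hω, hv₀, rfl⟩ := cs.exists_eq_mul_isCosetMin I v
  obtain ⟨ν, hν, hp, hmin⟩ := cs.exists_minimal_word I ω hω
  rw [← hp] at h ⊢
  cases ν with
  | nil => simpa using hv₀
  | cons i ν =>
    refine absurd ?_ (h i (hν i (by simp)))
    have h₁ := hv₀.length_wordProd_mul hν hmin
    have h₂ := cs.length_mul_le (cs.wordProd ν) v₀
    have h₃ := cs.length_wordProd_le ν
    rw [IsLeftDescent, h₁, wordProd_cons, mul_assoc, simple_mul_simple_cancel_left,
      List.length_cons]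
    omega

lemma lengthAdditive_wordProd_of_not_isRightDescent {I : Set B} {y : W}
    (h : ∀ i ∈ I, ¬ cs.IsRightDescent y i) {ω : List B} (hω : ∀ i ∈ ω, i ∈ I) :
    cs.LengthAdditive y (cs.wordProd ω) := by
  have hmin : cs.IsCosetMin I y⁻¹ :=
    isCosetMin_of_not_isLeftDescent fun i hi => by simpa [isLeftDescent_inv_iff] using h i hi
  have := (hmin.lengthAdditive (ω := ω.reverse) (by simpa using hω)).inv
  simpa using this

/-- If all elements of `I` are left descents of `u`, then `u` has a prefix in `W_I` of which all
elements of `I` are left descents. -/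
lemma exists_isPrefix_wordProd {I : Set B} {u : W} (h : ∀ i ∈ I, cs.IsLeftDescent u i) :
    ∃ ω : List B, (∀ i ∈ ω, i ∈ I) ∧ cs.IsPrefix (cs.wordProd ω) u ∧
      ∀ i ∈ I, cs.IsPrefix (cs.simple i) (cs.wordProd ω) := by
  obtain ⟨ω, v, hω, hv, rfl⟩ := cs.exists_eq_mul_isCosetMin I u
  refine ⟨ω, hω, (hv.lengthAdditive hω).isPrefix, fun i hi => ?_⟩
  rw [isPrefix_simple_iff]
  have h₁ := h i hi
  have h₂ := hv.lengthAdditive hω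
  have h₃ := hv.lengthAdditive (ω := i :: ω) (by simpa using ⟨hi, hω⟩)
  unfold IsLeftDescent LengthAdditive at *
  rw [wordProd_cons, mul_assoc] at h₃
  omega

/-- If `z ≠ p` is a prefix of `p`, then some `zs` covering `z` is a prefix of `p`. -/
lemma IsPrefix.exists_simple {z p : W} (h : cs.IsPrefix z p) (hne : p ≠ z) :
    ∃ i, cs.LengthAdditive z (cs.simple i) ∧ cs.IsPrefix (z * cs.simple i) p := by
  obtain ⟨u, hu, rfl⟩ := h.exists_eq_mul
  obtain ⟨i, hi⟩ := cs.exists_leftDescent_of_ne_one (w := u) (by rintro rfl; simp at hne)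
  have hi' := isPrefix_simple_iff.2 hi
  exact ⟨i, hu.of_isPrefix hi', hi'.mul_left hu⟩

variable (cs)

lemma exists_greatest_prefix_above (x y : W) (n : ℕ) :
    ∀ z, cs.length y - cs.length z = n → cs.IsPrefix z y → cs.LengthAdditive x z →
      ∃ m, cs.IsPrefix m y ∧ cs.LengthAdditive x m ∧ cs.IsPrefix z m ∧
        ∀ p, cs.IsPrefix p y → cs.LengthAdditive x p → cs.IsPrefix z p → cs.IsPrefix p m := by
  induction n using Nat.strong_induction_on with
  | _ n ih =>
  intro z hn hzy hxz
  by_cases hex : ∃ i, cs.LengthAdditive z (cs.simple i) ∧ cs.IsPrefix (z * cs.simple i) y ∧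
      cs.LengthAdditive x (z * cs.simple i)
  swap
  · refine ⟨z, hzy, hxz, cs.isPrefix_refl z, fun p hp hxp hzp => ?_⟩
    by_cases hpz : p = z
    · exact hpz ▸ cs.isPrefix_refl z
    · obtain ⟨i, hi, hip⟩ := hzp.exists_simple hpz
      exact absurd ⟨i, hi, hip.trans hp, hxp.of_isPrefix hip⟩ hex
  have up : ∀ i, cs.LengthAdditive z (cs.simple i) → cs.IsPrefix (z * cs.simple i) y →
      cs.LengthAdditive x (z * cs.simple i) →
      ∃ m, cs.IsPrefix m y ∧ cs.LengthAdditive x m ∧ cs.IsPrefix (z * cs.simple i) m ∧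
        ∀ p, cs.IsPrefix p y → cs.LengthAdditive x p → cs.IsPrefix (z * cs.simple i) p →
          cs.IsPrefix p m := by
    intro i hi hiy hxi
    refine ih _ ?_ _ rfl hiy hxi
    have := hiy.length_le
    unfold LengthAdditive at hi
    rw [length_simple] at hi
    omega
  obtain ⟨i₀, hi₀, hiy₀, hxi₀⟩ := hex
  obtain ⟨m, hmy, hxm, hzm, hmax⟩ := up i₀ hi₀ hiy₀ hxi₀
  refine ⟨m, hmy, hxm, hi₀.isPrefix.trans hzm, fun p hp hxp hzp => ?_⟩
  by_cases hpz : p = z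
  · rw [hpz]; exact hi₀.isPrefix.trans hzm
  obtain ⟨i, hi, hip⟩ := hzp.exists_simple hpz
  have hiy := hip.trans hp
  have hxi := hxp.of_isPrefix hip
  obtain ⟨m', hmy', hxm', hzm', hmax'⟩ := up i hi hiy hxi
  obtain ⟨u, hu, rfl⟩ := hzy.exists_eq_mul
  obtain ⟨ω, hω, hωu, hωI⟩ := exists_isPrefix_wordProd (cs := cs) (I := {i₀, i}) (u := u) (by
    rintro j (rfl | rfl)
    · exact isPrefix_simple_iff.1 (hiy₀.of_mul_left hi₀)
    · exact isPrefix_simple_iff.1 (hiy.of_mul_left hi))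
  have hzω : cs.LengthAdditive z (cs.wordProd ω) := hu.of_isPrefix hωu
  have hxzω : cs.LengthAdditive (x * z) (cs.wordProd ω) := by
    refine lengthAdditive_wordProd_of_not_isRightDescent (I := {i₀, i}) ?_ hω
    rintro j (rfl | rfl)
    · exact lengthAdditive_simple_iff.1 (hi₀.assoc_left hxi₀).2
    · exact lengthAdditive_simple_iff.1 (hi.assoc_left hxi).2
  have hxω := (hxz.assoc_right hxzω).2
  have hωy := hωu.mul_left hu
  have h₀ : cs.IsPrefix (z * cs.simple i₀) (z * cs.wordProd ω) := (hωI i₀ (by simp)).mul_left hzω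
  have h₁ : cs.IsPrefix (z * cs.simple i) (z * cs.wordProd ω) := (hωI i (by simp)).mul_left hzω
  have hmm' : cs.IsPrefix m m' := hmax' m hmy hxm (h₁.trans (hmax _ hωy hxω h₀))
  have hm'm : cs.IsPrefix m' m := hmax m' hmy' hxm' (h₀.trans (hmax' _ hωy hxω h₁))
  rw [hmm'.antisymm hm'm]
  exact hmax' p hp hxp hip

lemma exists_greatest_prefix (x y : W) :
    ∃ m, cs.IsPrefix m y ∧ cs.LengthAdditive x m ∧
      ∀ p, cs.IsPrefix p y → cs.LengthAdditive x p → cs.IsPrefix p m := by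
  have one : ∀ p, cs.IsPrefix 1 p := fun p => by simp [IsPrefix, LengthAdditive]
  obtain ⟨m, h₁, h₂, -, h₃⟩ := cs.exists_greatest_prefix_above x y _ 1 rfl (one y)
    (cs.lengthAdditive_one_right x)
  exact ⟨m, h₁, h₂, fun p hp hxp => h₃ p hp hxp (one p)⟩

/-- The greatest prefix `m` of `y` for which `xm` is length-additive. -/
noncomputable def absorb (x y : W) : W := (cs.exists_greatest_prefix x y).choose

lemma absorb_isPrefix (x y : W) : cs.IsPrefix (cs.absorb x y) y :=
  (cs.exists_greatest_prefix x y).choose_spec.1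

lemma lengthAdditive_absorb (x y : W) : cs.LengthAdditive x (cs.absorb x y) :=
  (cs.exists_greatest_prefix x y).choose_spec.2.1

lemma isPrefix_absorb {x y p : W} (h : cs.IsPrefix p y) (hx : cs.LengthAdditive x p) :
    cs.IsPrefix p (cs.absorb x y) :=
  (cs.exists_greatest_prefix x y).choose_spec.2.2 p h hx

variable {cs}

/-- The compatibility of `absorb` with length-additive products. -/
lemma LengthAdditive.absorb_mul {x y : W} (h : cs.LengthAdditive x y) (z : W) :
    cs.absorb x (y * cs.absorb y z) = y * cs.absorb (x * y) z := by
  have hyz := cs.lengthAdditive_absorb y z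
  have hxyz := cs.lengthAdditive_absorb (x * y) z
  apply IsPrefix.antisymm
  · obtain ⟨v, hv, he⟩ := (cs.isPrefix_absorb hyz.isPrefix h).exists_eq_mul
    have h₁ := cs.absorb_isPrefix x (y * cs.absorb y z)
    have h₂ := cs.lengthAdditive_absorb x (y * cs.absorb y z)
    rw [he] at h₁ h₂ ⊢
    exact (cs.isPrefix_absorb ((h₁.of_mul_left hv).trans (cs.absorb_isPrefix y z))
      (hv.assoc_left h₂).2).mul_left (h.assoc_right hxyz).1
  · have h₁ := h.assoc_right hxyz
    exact cs.isPrefix_absorb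
      ((cs.isPrefix_absorb (cs.absorb_isPrefix (x * y) z) h₁.1).mul_left hyz) h₁.2


variable (cs) in
/-- The complement `m⁻¹y` of the prefix `m = absorb x y` in `y`. -/
noncomputable def residue (x y : W) : W := (cs.absorb x y)⁻¹ * y

variable (cs) in
lemma absorb_mul_residue (x y : W) : cs.absorb x y * cs.residue x y = y :=
  mul_inv_cancel_left _ _

variable (cs) in
lemma lengthAdditive_absorb_residue (x y : W) :
    cs.LengthAdditive (cs.absorb x y) (cs.residue x y) :=
  cs.absorb_isPrefix x y

lemma LengthAdditive.residue_mul_residue {x y : W} (h : cs.LengthAdditive x y) (z : W) :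
    cs.residue x (y * cs.absorb y z) * cs.residue y z = cs.residue (x * y) z := by
  simp [residue, h.absorb_mul, mul_assoc]

lemma LengthAdditive.lengthAdditive_residue {x y : W} (h : cs.LengthAdditive x y) (z : W) :
    cs.LengthAdditive (cs.residue x (y * cs.absorb y z)) (cs.residue y z) := by
  have h₁ := cs.lengthAdditive_absorb_residue (x * y) z
  have h₂ := cs.lengthAdditive_absorb_residue x (y * cs.absorb y z)
  have h₃ := cs.lengthAdditive_absorb_residue y z
  have h₄ := cs.lengthAdditive_absorb y z
  have h₅ := (h.assoc_right (cs.lengthAdditive_absorb (x * y) z)).1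
  have h₆ := h.absorb_mul z
  have h₇ := h.residue_mul_residue z
  unfold LengthAdditive at *
  rw [absorb_mul_residue] at h₁ h₂ h₃
  rw [h₇]
  rw [h₆] at h₂
  omega

end CoxeterSystem

namespace BraidMonoid

open CoxeterSystem

variable (cs : CoxeterSystem M W)

lemma bOf_mul {x y : W} (h : cs.LengthAdditive x y) : bOf cs (x * y) = bOf cs x * bOf cs y :=
  (PresentedMonoid.mk_eq_mk_of_rel ⟨x, y, h, rfl, rfl⟩).symm

lemma bPi_bOf (x : W) : bPi cs (bOf cs x) = x := rfl

variable {cs}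

lemma induction_left {p : BraidMonoid cs → Prop} (one : p 1)
    (bOf_mul : ∀ w b, p b → p (bOf cs w * b)) (b : BraidMonoid cs) : p b := by
  induction b using PresentedMonoid.inductionOn with
  | _ b =>
  induction b using FreeMonoid.inductionOn' with
  | one => exact one
  | of_mul w b ih => exact bOf_mul w _ ih

variable (cs) in
lemma bOf_one_mul_bOf (w : W) : bOf cs 1 * bOf cs w = bOf cs w := by
  rw [← BraidMonoid.bOf_mul cs (by simp [LengthAdditive]), one_mul]

lemma bOf_one_mul_bOf_mul (w : W) (b : BraidMonoid cs) :
    bOf cs 1 * (bOf cs w * b) = bOf cs w * b := by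
  rw [← mul_assoc, bOf_one_mul_bOf]

/-- The generator `𝟏` acts as the identity on all elements different from `1`. -/
lemma bOf_one_mul {b : BraidMonoid cs} (hb : b ≠ 1) : bOf cs 1 * b = b := by
  induction b using induction_left with
  | one => exact absurd rfl hb
  | bOf_mul w b => exact bOf_one_mul_bOf_mul w b

lemma bOf_one_mul_mul_bOf (b : BraidMonoid cs) (w : W) :
    bOf cs 1 * (b * bOf cs w) = b * bOf cs w := by
  induction b using induction_left with
  | one => rw [one_mul, bOf_one_mul_bOf]
  | bOf_mul v b => rw [mul_assoc, bOf_one_mul_bOf_mul]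

variable (cs) in
/-- The additive length of an element of the braid monoid. -/
noncomputable def len (b : BraidMonoid cs) : ℕ := (bLen cs b).toAdd

lemma len_one : len cs 1 = 0 := by simp [len]

lemma len_mul (a b : BraidMonoid cs) : len cs (a * b) = len cs a + len cs b := by simp [len]

lemma len_bOf (w : W) : len cs (bOf cs w) = cs.length w := rfl

lemma length_bPi_le (b : BraidMonoid cs) : cs.length (bPi cs b) ≤ len cs b := by
  induction b using induction_left with
  | one => simp
  | bOf_mul w b ih =>
    rw [map_mul, bPi_bOf, len_mul, len_bOf]
    exact (cs.length_mul_le _ _).trans (by omega)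

/-- Elements of `𝐖` come from elements of `W`. -/
lemma bOf_one_mul_of_length_eq {b : BraidMonoid cs} (hb : len cs b = cs.length (bPi cs b)) :
    bOf cs 1 * b = bOf cs (bPi cs b) := by
  induction b using induction_left with
  | one => simp
  | bOf_mul w b ih =>
    rw [map_mul, bPi_bOf, len_mul, len_bOf] at hb
    have h₁ := cs.length_mul_le w (bPi cs b)
    have h₂ := length_bPi_le b
    have h₃ : cs.LengthAdditive w (bPi cs b) := by unfold LengthAdditive; omega
    have h₄ : bOf cs w * bOf cs 1 = bOf cs w := by
      rw [← BraidMonoid.bOf_mul cs (cs.lengthAdditive_one_right w), mul_one]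
    rw [map_mul, bPi_bOf, BraidMonoid.bOf_mul cs h₃, ← ih (by omega), bOf_one_mul_bOf_mul,
      ← mul_assoc, h₄]

lemma eq_bOf_bPi {b : BraidMonoid cs} (hb : b ∈ bW cs) (h1 : b ≠ 1) : b = bOf cs (bPi cs b) := by
  rw [← bOf_one_mul_of_length_eq (congrArg Multiplicative.toAdd hb), bOf_one_mul h1]

variable (cs) in
lemma bOf_mem_bW (w : W) : bOf cs w ∈ bW cs := rfl

lemma exists_eq_bOf_simple {b : BraidMonoid cs} (hb : len cs b = 1) :
    ∃ i, b = bOf cs (cs.simple i) := by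
  have key : len cs b ≤ 1 → len cs b = cs.length (bPi cs b) := by
    clear hb
    induction b using induction_left with
    | one => simp [len_one]
    | bOf_mul w b ih =>
      intro h
      rw [len_mul, len_bOf] at h
      have ih := ih (by omega)
      rw [len_mul, len_bOf, map_mul, bPi_bOf]
      rcases Nat.eq_zero_or_pos (cs.length w) with hw | hw
      · rw [hw, cs.length_eq_zero_iff.1 hw, one_mul, ih, zero_add]
      · have hb : bPi cs b = 1 := cs.length_eq_zero_iff.1 (by omega)
        rw [hb, mul_one, ih, hb, length_one, add_zero]
  have h1 : b ≠ 1 := by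
    rintro rfl
    simp [len_one] at hb
  have h := key hb.le
  obtain ⟨i, hi⟩ := cs.length_eq_one_iff.1 (h.symm.trans hb)
  exact ⟨i, by rw [← hi, ← bOf_one_mul_of_length_eq h, bOf_one_mul h1]⟩

variable (cs) in
/-- Left multiplication on decompositions of elements of the braid monoid as a product of an
element of `𝐖` and a remainder. -/
noncomputable def headAction : BraidMonoid cs →* Function.End (W × BraidMonoid cs) :=
  PresentedMonoid.lift (M := Function.End (W × BraidMonoid cs))
    (fun w p => (w * cs.absorb w p.1, bOf cs (cs.residue w p.1) * p.2)) (by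
      rintro _ _ ⟨x, y, h, rfl, rfl⟩
      replace h : cs.LengthAdditive x y := h
      rw [map_mul]
      funext p
      refine Prod.ext ?_ ?_
      · change x * cs.absorb x (y * cs.absorb y p.1) = x * y * cs.absorb (x * y) p.1
        rw [h.absorb_mul, mul_assoc]
      · change bOf cs (cs.residue x (y * cs.absorb y p.1)) * (bOf cs (cs.residue y p.1) * p.2) =
          bOf cs (cs.residue (x * y) p.1) * p.2
        rw [← mul_assoc, ← BraidMonoid.bOf_mul cs (h.lengthAdditive_residue p.1),
          h.residue_mul_residue])

lemma headAction_bOf_mul (w : W) (b : BraidMonoid cs) (p : W × BraidMonoid cs) :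
    headAction cs (bOf cs w * b) p =
      (w * cs.absorb w (headAction cs b p).1,
        bOf cs (cs.residue w (headAction cs b p).1) * (headAction cs b p).2) := by
  rw [map_mul]
  rfl

lemma bOf_absorb_mul (w v : W) (b : BraidMonoid cs) :
    bOf cs (cs.absorb w v) * (bOf cs (cs.residue w v) * b) = bOf cs v * b := by
  rw [← mul_assoc, ← BraidMonoid.bOf_mul cs (cs.lengthAdditive_absorb_residue w v),
    absorb_mul_residue]

variable (cs) in
/-- The head of `b`, the greatest element of `𝐖` dividing `b` on the left. -/
noncomputable def head (b : BraidMonoid cs) : W := (headAction cs b (1, bOf cs 1)).1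

variable (cs) in
/-- The remainder of `b` after division by its head. -/
noncomputable def tail (b : BraidMonoid cs) : BraidMonoid cs :=
  (headAction cs b (1, bOf cs 1)).2

lemma head_bOf_mul (w : W) (b : BraidMonoid cs) :
    head cs (bOf cs w * b) = w * cs.absorb w (head cs b) := by
  rw [head, headAction_bOf_mul, head]

lemma tail_bOf_mul (w : W) (b : BraidMonoid cs) :
    tail cs (bOf cs w * b) = bOf cs (cs.residue w (head cs b)) * tail cs b := by
  rw [tail, headAction_bOf_mul, head, tail]

lemma bOf_head_mul_tail_aux (b : BraidMonoid cs) :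
    bOf cs (head cs b) * tail cs b = b * bOf cs 1 := by
  induction b using induction_left with
  | one =>
    rw [one_mul, head, tail, map_one]
    exact bOf_one_mul_bOf cs 1
  | bOf_mul w b ih =>
    rw [head_bOf_mul, tail_bOf_mul, BraidMonoid.bOf_mul cs (cs.lengthAdditive_absorb _ _),
      mul_assoc, bOf_absorb_mul, ih, mul_assoc]

lemma bOf_head_mul_tail (b : BraidMonoid cs) :
    bOf cs (head cs b) * tail cs b = bOf cs 1 * b := by
  have h : b * bOf cs 1 = bOf cs 1 * b := by
    induction b using induction_left with
    | one => rw [one_mul, mul_one]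
    | bOf_mul w b ih =>
      rw [bOf_one_mul_bOf_mul, mul_assoc, ih, ← mul_assoc,
        ← BraidMonoid.bOf_mul cs (cs.lengthAdditive_one_right w), mul_one]
  rw [bOf_head_mul_tail_aux, h]

/-- Left cancellation of elements of `𝐖`. -/
lemma bOf_mul_left_cancel {w : W} {a b : BraidMonoid cs} (h : bOf cs w * a = bOf cs w * b) :
    bOf cs 1 * a = bOf cs 1 * b := by
  have h₁ := congrArg (head cs) h
  have h₂ := congrArg (tail cs) h
  rw [head_bOf_mul, head_bOf_mul, mul_right_inj] at h₁
  rw [tail_bOf_mul, tail_bOf_mul] at h₂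
  rw [← bOf_head_mul_tail, ← bOf_head_mul_tail, ← bOf_absorb_mul w, h₁, h₂, bOf_absorb_mul]

/-- If `𝐰` divides `tb`, then it divides the product of `t` with the head of `b`. -/
lemma exists_bOf_mul_eq {w t : W} {a b : BraidMonoid cs} (h : bOf cs w * a = bOf cs t * b) :
    ∃ z, bOf cs w * z = bOf cs t * bOf cs (head cs b) := by
  have h₁ := congrArg (head cs) h
  rw [head_bOf_mul, head_bOf_mul] at h₁
  refine ⟨bOf cs (cs.absorb w (head cs a)) * bOf cs (cs.residue t (head cs b)), ?_⟩
  rw [← mul_assoc, ← BraidMonoid.bOf_mul cs (cs.lengthAdditive_absorb _ _), h₁,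
    BraidMonoid.bOf_mul cs (cs.lengthAdditive_absorb _ _), mul_assoc,
    ← BraidMonoid.bOf_mul cs (cs.lengthAdditive_absorb_residue _ _), absorb_mul_residue]

/-- If `𝐰` is divisible by the head of `𝐰b` and `𝐰b` conjugates `s` to an element of `S`, then
`b` conjugates `s` to an element of `S`. -/
lemma exists_mul_simple_eq {w : W} {b : BraidMonoid cs} {i t : B}
    (hw : ∃ z, bOf cs (head cs (bOf cs w * b)) * z = bOf cs w)
    (h : bOf cs w * b * bOf cs (cs.simple i) = bOf cs (cs.simple t) * (bOf cs w * b)) :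
    ∃ t', b * bOf cs (cs.simple i) = bOf cs (cs.simple t') * b := by
  rw [mul_assoc] at h
  obtain ⟨y, hy⟩ := exists_bOf_mul_eq h
  obtain ⟨z, hz⟩ := hw
  have hyz : bOf cs w * (y * z) = bOf cs (cs.simple t) * bOf cs w := by
    rw [← mul_assoc, hy, mul_assoc, hz]
  have hlen := congrArg (len cs) hyz
  simp only [len_mul y z, len_mul (bOf cs _), len_bOf, length_simple] at hlen
  obtain ⟨t', ht'⟩ := exists_eq_bOf_simple (cs := cs) (b := y * z) (by rw [len_mul]; omega)
  refine ⟨t', ?_⟩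
  rw [ht'] at hyz
  rw [← mul_assoc (bOf cs (cs.simple t)), ← hyz, mul_assoc] at h
  have := bOf_mul_left_cancel h
  rwa [bOf_one_mul_mul_bOf, bOf_one_mul_bOf_mul] at this

end BraidMonoid

/-- Let `w ∈ B⁺` and `s ∈ S` be such that `w·𝐬 = b·w` for some
`b ∈ B⁺`, and let `w = w₁⋯w_k` be the normal form of `w`. Then for every `i`, there
is a `t ∈ S` with `(w_i⋯w_k)·𝐬 = 𝐭·(w_i⋯w_k)`. -/
theorem stmt10 [Finite W] (cs : CoxeterSystem M W) (w : BraidMonoid cs) (i : B)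
    (hconj : ∃ b : BraidMonoid cs, w * bOf cs (cs.simple i) = b * w)
    (L : List (BraidMonoid cs))
    (hmem : ∀ u ∈ L, u ∈ bW cs ∧ u ≠ 1) (hprod : L.prod = w)
    (hnf : ∀ j : ℕ, ∀ hj : j < L.length, ∀ c ∈ bW cs,
      (∃ z, c * z = (L.drop j).prod) → ∃ z, c * z = L.get ⟨j, hj⟩) :
    ∀ j : ℕ, j < L.length →
      ∃ t ∈ Set.range cs.simple,
        (L.drop j).prod * bOf cs (cs.simple i) = bOf cs t * (L.drop j).prod := by
  subst hprod
  suffices h : ∀ j : ℕ, j < L.length →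
      ∃ t, (L.drop j).prod * bOf cs (cs.simple i) = bOf cs (cs.simple t) * (L.drop j).prod by
    intro j hj
    obtain ⟨t, ht⟩ := h j hj
    exact ⟨_, ⟨t, rfl⟩, ht⟩
  intro j
  induction j with
  | zero =>
    intro _
    obtain ⟨b, hb⟩ := hconj
    have hlen := congrArg (BraidMonoid.len cs) hb
    simp only [BraidMonoid.len_mul, BraidMonoid.len_bOf, CoxeterSystem.length_simple] at hlen
    obtain ⟨t, rfl⟩ := BraidMonoid.exists_eq_bOf_simple (cs := cs) (b := b) (by omega)
    exact ⟨t, hb⟩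
  | succ j ih =>
    intro hj
    obtain ⟨t, ht⟩ := ih (by omega)
    have hj' : j < L.length := by omega
    have hget := BraidMonoid.eq_bOf_bPi (hmem _ (L.get_mem ⟨j, hj'⟩)).1
      (hmem _ (L.get_mem ⟨j, hj'⟩)).2
    have hdrop : (L.drop j).prod =
        bOf cs (bPi cs (L.get ⟨j, hj'⟩)) * (L.drop (j + 1)).prod := by
      rw [← hget, List.drop_eq_getElem_cons hj', List.prod_cons, List.get_eq_getElem]
    rw [hdrop] at ht
    refine BraidMonoid.exists_mul_simple_eq ?_ ht
    rw [← hdrop, ← hget]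
    refine hnf j hj' _ (BraidMonoid.bOf_mem_bW cs _) ⟨_, BraidMonoid.bOf_head_mul_tail _ |>.trans ?_⟩
    rw [hdrop, BraidMonoid.bOf_one_mul_bOf_mul]
end
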